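/- arXiv:1805.05229 — 2 statements merged into one kernel-verified Lean document; each statement's English description precedes it below -/
import Mathlib

section
/- With B(x) = (1/2π)∫_ℝ e^{ixξ}e^{iξ⁵}dξ, one has ∫₀^∞ B(y) dy = 2/5. -/
open Filter intervalIntegral

lemma aux_swap (f : ℝ → ℝ → ℝ) (hf : Continuous (Function.uncurry f)) (a b c d : ℝ) :
    ∫ x in a..b, ∫ y in c..d, f x y = ∫ y in c..d, ∫ x in a..b, f x y := by
  rw [MeasureTheory.intervalIntegral_intervalIntegral_swap]
  exact (hf.continuousOn.integrableOn_compact (isCompact_uIcc.prod isCompact_uIcc)).mono_set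
    (Set.prod_mono Set.uIoc_subset_uIcc Set.uIoc_subset_uIcc)

lemma aux_ibp (a b K M : ℝ) (ha : 0 ≤ a) (hab : a ≤ b) (u u' v v' : ℝ → ℝ)
    (hu : ∀ x, a ≤ x → HasDerivAt u (u' x) x) (hv : ∀ x, HasDerivAt v (v' x) x)
    (hu' : ContinuousOn u' (Set.Ici a)) (hv' : Continuous v')
    (hM : ∀ x, a ≤ x → |u x| ≤ M) (hK : ∀ x, a ≤ x → |u' x| ≤ K * (1 / (1 + x ^ 2)))
    (hv1 : ∀ x, |v x| ≤ 1) : |∫ x in a..b, u x * v' x| ≤ 2 * M + 2 * K := by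
  have hsub : Set.uIcc a b ⊆ Set.Ici a := by
    rw [Set.uIcc_of_le hab]; exact Set.Icc_subset_Ici_self
  have hK0 : 0 ≤ K := by
    have h := (abs_nonneg _).trans (hK a le_rfl)
    have h2 : 0 < 1 / (1 + a ^ 2) := by positivity
    exact nonneg_of_mul_nonneg_left h h2
  have hM0 : 0 ≤ M := (abs_nonneg _).trans (hM a le_rfl)
  rw [integral_mul_deriv_eq_deriv_mul (fun x hx => hu x (hsub hx)) (fun x _ => hv x)
    ((hu'.mono hsub).intervalIntegrable) (hv'.intervalIntegrable _ _)]
  have hprod : ∀ x, a ≤ x → |u x * v x| ≤ M := by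
    intro x hx
    rw [abs_mul]
    calc |u x| * |v x| ≤ M * 1 := mul_le_mul (hM x hx) (hv1 x) (abs_nonneg _) hM0
      _ = M := mul_one M
  have h3 : |∫ x in a..b, u' x * v x| ≤ ∫ x in a..b, K * (1 / (1 + x ^ 2)) := by
    rw [← Real.norm_eq_abs]
    apply intervalIntegral.norm_integral_le_of_norm_le hab
    · refine Filter.Eventually.of_forall fun x hx => ?_
      rw [Real.norm_eq_abs, abs_mul]
      calc |u' x| * |v x| ≤ K * (1 / (1 + x ^ 2)) * 1 :=
            mul_le_mul (hK x hx.1.le) (hv1 x) (abs_nonneg _) (by positivity)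
        _ = _ := mul_one _
    · apply Continuous.intervalIntegrable
      exact continuous_const.mul (continuous_const.div (by fun_prop) (fun x => by positivity))
  have h4 : ∫ x in a..b, K * (1 / (1 + x ^ 2)) ≤ 2 * K := by
    rw [intervalIntegral.integral_const_mul, integral_one_div_one_add_sq]
    have h5 := Real.arctan_lt_pi_div_two b
    have h6 : 0 ≤ Real.arctan a := Real.arctan_nonneg.2 ha
    have h7 := Real.pi_le_four
    nlinarith
  have h1 := abs_le.1 (hprod a le_rfl)
  have h2 := abs_le.1 (hprod b hab)
  have h3' := abs_le.1 h3
  rw [abs_le]; constructor <;> linarith [h1.1, h1.2, h2.1, h2.2, h3'.1, h3'.2]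

lemma aux_inner (t R : ℝ) : ∫ x in (0:ℝ)..R, Real.sin x * Real.exp (-(x * t)) =
    1 / (1 + t ^ 2) - Real.exp (-(R * t)) * (Real.cos R + t * Real.sin R) / (1 + t ^ 2) := by
  have hne : 1 + t ^ 2 ≠ 0 := by positivity
  rw [integral_eq_sub_of_hasDerivAt (f := fun x => -(Real.exp (-(x * t)) * (Real.cos x + t * Real.sin x) / (1 + t ^ 2)))]
  · simp; ring
  · intro x _
    have h1 : HasDerivAt (fun x : ℝ => Real.exp (-(x * t))) (Real.exp (-(x * t)) * (-(1 * t))) x :=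
      (((hasDerivAt_id x).mul_const t).neg).exp
    have h2 : HasDerivAt (fun x : ℝ => Real.cos x + t * Real.sin x) (-Real.sin x + t * Real.cos x) x :=
      (Real.hasDerivAt_cos x).add ((Real.hasDerivAt_sin x).const_mul t)
    refine (((h1.mul h2).div_const (1 + t ^ 2)).neg).congr_deriv ?_
    field_simp
    ring
  · apply Continuous.intervalIntegrable; fun_prop

lemma aux_inner2 (x S : ℝ) : ∫ t in (0:ℝ)..S, Real.sin x * Real.exp (-(x * t)) =
    Real.sinc x - Real.sinc x * Real.exp (-(S * x)) := by
  rcases eq_or_ne x 0 with rfl | hx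
  · simp
  rw [integral_eq_sub_of_hasDerivAt (f := fun t => -(Real.sin x / x * Real.exp (-(x * t))))]
  · rw [Real.sinc_of_ne_zero hx, mul_comm S x]; simp; ring
  · intro t _
    have h1 : HasDerivAt (fun t : ℝ => Real.exp (-(x * t))) (Real.exp (-(x * t)) * (-(x * 1))) t :=
      (((hasDerivAt_id t).const_mul x).neg).exp
    refine ((h1.const_mul (Real.sin x / x)).neg).congr_deriv ?_
    field_simp
  · apply Continuous.intervalIntegrable; fun_prop

lemma aux_exp_int (a S : ℝ) (ha : 0 < a) :
    ∫ t in (0:ℝ)..S, Real.exp (-(a * t)) ≤ 1 / a := by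
  rw [integral_eq_sub_of_hasDerivAt (f := fun t => -(1 / a * Real.exp (-(a * t))))]
  · have : 0 < 1 / a * Real.exp (-(a * S)) := by positivity
    simp at *; linarith
  · intro t _
    have h1 : HasDerivAt (fun t : ℝ => Real.exp (-(a * t))) (Real.exp (-(a * t)) * (-(a * 1))) t :=
      (((hasDerivAt_id t).const_mul a).neg).exp
    refine ((h1.const_mul (1 / a)).neg).congr_deriv ?_
    field_simp
  · apply Continuous.intervalIntegrable; fun_prop

lemma aux_dir (R S : ℝ) (hR : 0 < R) (hS : 0 < S) :
    |(∫ x in (0:ℝ)..R, Real.sinc x) - Real.arctan S| ≤ 2 / R + 1 / S := by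
  have hsc := Real.continuous_sinc
  have h := aux_swap (fun x t => Real.sin x * Real.exp (-(x * t))) (by fun_prop) 0 R 0 S
  simp only [aux_inner, aux_inner2] at h
  have c1 : Continuous (fun t : ℝ => 1 / (1 + t ^ 2)) :=
    continuous_const.div (by fun_prop) (fun x => by positivity)
  have c2 : Continuous (fun t : ℝ =>
      Real.exp (-(R * t)) * (Real.cos R + t * Real.sin R) / (1 + t ^ 2)) :=
    Continuous.div (by fun_prop) (by fun_prop) (fun x => by positivity)
  rw [integral_sub (hsc.intervalIntegrable _ _)
      (Continuous.intervalIntegrable (by fun_prop) _ _),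
    integral_sub (c1.intervalIntegrable _ _) (c2.intervalIntegrable _ _),
    integral_one_div_one_add_sq, Real.arctan_zero] at h
  have e1 : |∫ x in (0:ℝ)..R, Real.sinc x * Real.exp (-(S * x))| ≤ 1 / S := by
    refine le_trans ?_ (aux_exp_int S R hS)
    rw [← Real.norm_eq_abs]
    apply intervalIntegral.norm_integral_le_of_norm_le hR.le
    · refine Filter.Eventually.of_forall fun x hx => ?_
      rw [Real.norm_eq_abs, abs_mul, Real.abs_exp]
      have := Real.abs_sinc_le_one x
      have := Real.exp_pos (-(S * x))
      nlinarith
    · apply Continuous.intervalIntegrable; fun_prop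
  have e2 : |∫ t in (0:ℝ)..S, Real.exp (-(R * t)) * (Real.cos R + t * Real.sin R) / (1 + t ^ 2)| ≤ 2 / R := by
    have h0 : ∫ t in (0:ℝ)..S, 2 * Real.exp (-(R * t)) ≤ 2 / R := by
      rw [intervalIntegral.integral_const_mul]
      have := aux_exp_int R S hR
      calc _ ≤ 2 * (1 / R) := by linarith
        _ = _ := by ring
    refine le_trans ?_ h0
    rw [← Real.norm_eq_abs]
    apply intervalIntegral.norm_integral_le_of_norm_le hS.le
    · refine Filter.Eventually.of_forall fun t ht => ?_
      have ht0 : 0 < t := ht.1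
      rw [Real.norm_eq_abs, abs_div, abs_mul, Real.abs_exp, abs_of_pos (show 0 < 1 + t ^ 2 by positivity),
        div_le_iff₀ (by positivity)]
      have hc := abs_le.1 (Real.abs_cos_le_one R)
      have hs := abs_le.1 (Real.abs_sin_le_one R)
      have : |Real.cos R + t * Real.sin R| ≤ 2 * (1 + t ^ 2) := by
        rw [abs_le]; constructor <;> nlinarith [sq_nonneg (t - 1)]
      have := mul_le_mul_of_nonneg_left this (Real.exp_pos (-(R * t))).le
      linarith
    · apply Continuous.intervalIntegrable; fun_prop
  have e1' := abs_le.1 e1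
  have e2' := abs_le.1 e2
  rw [abs_le]; constructor <;> linarith [e1'.1, e1'.2, e2'.1, e2'.2]

lemma aux_dirichlet : Tendsto (fun R : ℝ => ∫ x in (0:ℝ)..R, Real.sinc x) atTop (nhds (Real.pi / 2)) := by
  have key : ∀ R : ℝ, 0 < R → |(∫ x in (0:ℝ)..R, Real.sinc x) - Real.pi / 2| ≤ 2 / R := by
    intro R hR
    have h1 : Tendsto (fun S : ℝ => |(∫ x in (0:ℝ)..R, Real.sinc x) - Real.arctan S|) atTop
        (nhds |(∫ x in (0:ℝ)..R, Real.sinc x) - Real.pi / 2|) :=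
      (tendsto_const_nhds.sub (Real.tendsto_arctan_atTop.mono_right nhdsWithin_le_nhds)).abs
    have h2 : Tendsto (fun S : ℝ => 2 / R + 1 / S) atTop (nhds (2 / R + 0)) :=
      tendsto_const_nhds.add (tendsto_const_nhds.div_atTop tendsto_id)
    rw [add_zero] at h2
    refine le_of_tendsto_of_tendsto h1 h2 ?_
    filter_upwards [eventually_gt_atTop 0] with S hS using aux_dir R S hR hS
  rw [tendsto_iff_dist_tendsto_zero]
  refine squeeze_zero' (Eventually.of_forall fun _ => dist_nonneg) ?_
    ((tendsto_const_nhds (x := (2:ℝ))).div_atTop tendsto_id)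
  filter_upwards [eventually_gt_atTop 0] with R hR
  rw [Real.dist_eq]; exact key R hR

lemma aux_phase_deriv (x ξ : ℝ) :
    HasDerivAt (fun ξ : ℝ => x * ξ + ξ ^ 5) (x + 5 * ξ ^ 4) ξ := by
  refine (((hasDerivAt_id ξ).const_mul x).add (hasDerivAt_pow 5 ξ)).congr_deriv ?_
  norm_num

lemma aux_bound (x R : ℝ) (hx : 0 ≤ x) (hR : 1 ≤ R) :
    |∫ ξ in (0:ℝ)..R, Real.cos (x * ξ + ξ ^ 5)| ≤ 7 := by
  have hc : Continuous (fun ξ : ℝ => Real.cos (x * ξ + ξ ^ 5)) := by fun_prop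
  rw [← integral_add_adjacent_intervals (hc.intervalIntegrable 0 1) (hc.intervalIntegrable 1 R)]
  have h1 : |∫ ξ in (0:ℝ)..1, Real.cos (x * ξ + ξ ^ 5)| ≤ 1 := by
    have := intervalIntegral.norm_integral_le_of_norm_le_const (a := 0) (b := 1) (C := 1)
      (f := fun ξ : ℝ => Real.cos (x * ξ + ξ ^ 5)) (fun t _ => Real.abs_cos_le_one _)
    simpa using this
  have hpos : ∀ ξ : ℝ, 1 ≤ ξ → 0 < x + 5 * ξ ^ 4 := fun ξ hξ => by positivity
  have h2 : |∫ ξ in (1:ℝ)..R, (1 / (x + 5 * ξ ^ 4)) *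
      (Real.cos (x * ξ + ξ ^ 5) * (x + 5 * ξ ^ 4))| ≤ 2 * 1 + 2 * 2 := by
    apply aux_ibp 1 R 2 1 zero_le_one hR (fun ξ => 1 / (x + 5 * ξ ^ 4))
      (fun ξ => -(20 * ξ ^ 3) / (x + 5 * ξ ^ 4) ^ 2) (fun ξ => Real.sin (x * ξ + ξ ^ 5))
    · intro ξ hξ
      have hd : HasDerivAt (fun ξ : ℝ => x + 5 * ξ ^ 4) (20 * ξ ^ 3) ξ := by
        refine (((hasDerivAt_pow 4 ξ).const_mul 5).const_add x).congr_deriv ?_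
        norm_num; ring
      refine ((hasDerivAt_const ξ (1:ℝ)).div hd (hpos ξ hξ).ne').congr_deriv ?_
      simp
    · intro ξ
      exact (aux_phase_deriv x ξ).sin
    · apply ContinuousOn.div (by fun_prop) (by fun_prop)
      intro ξ hξ
      exact pow_ne_zero 2 (hpos ξ hξ).ne'
    · fun_prop
    · intro ξ hξ
      have hp := hpos ξ hξ
      rw [abs_of_pos (by positivity), div_le_one hp]
      have : 1 ≤ ξ ^ 4 := one_le_pow₀ hξ
      linarith
    · intro ξ hξ
      have hp := hpos ξ hξ
      have hξ0 : 0 < ξ := by linarith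
      rw [abs_div, abs_neg, abs_of_pos (by positivity : 0 < 20 * ξ ^ 3),
        abs_of_pos (by positivity : 0 < (x + 5 * ξ ^ 4) ^ 2), mul_one_div,
        div_le_div_iff₀ (by positivity) (by positivity)]
      have e1 : (5 * ξ ^ 4) ^ 2 ≤ (x + 5 * ξ ^ 4) ^ 2 :=
        pow_le_pow_left₀ (by positivity) (by linarith) 2
      have e2 : ξ ^ 3 ≤ ξ ^ 8 := pow_le_pow_right₀ hξ (by norm_num)
      have e3 : ξ ^ 5 ≤ ξ ^ 8 := pow_le_pow_right₀ hξ (by norm_num)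
      nlinarith
    · intro ξ; exact Real.abs_sin_le_one _
  have h3 : ∫ ξ in (1:ℝ)..R, (1 / (x + 5 * ξ ^ 4)) *
      (Real.cos (x * ξ + ξ ^ 5) * (x + 5 * ξ ^ 4)) =
      ∫ ξ in (1:ℝ)..R, Real.cos (x * ξ + ξ ^ 5) := by
    apply integral_congr
    intro ξ hξ
    rw [Set.uIcc_of_le hR] at hξ
    have hp := hpos ξ hξ.1
    dsimp only
    field_simp
  rw [h3] at h2
  refine (abs_add_le _ _).trans ?_
  linarith

lemma aux_rem (Y R : ℝ) (hY : 1 ≤ Y) (hR : 0 ≤ R) :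
    |∫ ξ in (0:ℝ)..R, 4 * ξ ^ 3 / (Y + ξ ^ 4) * Real.sin (Y * ξ + ξ ^ 5)| ≤ 140 / Y := by
  have hY0 : 0 < Y := by linarith
  have h2 : |∫ ξ in (0:ℝ)..R, (4 * ξ ^ 3 / ((Y + ξ ^ 4) * (Y + 5 * ξ ^ 4))) *
      (Real.sin (Y * ξ + ξ ^ 5) * (Y + 5 * ξ ^ 4))| ≤ 2 * (4 / Y) + 2 * (66 / Y) := by
    apply aux_ibp 0 R (66 / Y) (4 / Y) le_rfl hR
      (fun ξ => 4 * ξ ^ 3 / ((Y + ξ ^ 4) * (Y + 5 * ξ ^ 4)))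
      (fun ξ => (12 * ξ ^ 2 * ((Y + ξ ^ 4) * (Y + 5 * ξ ^ 4)) -
        4 * ξ ^ 3 * (4 * ξ ^ 3 * (Y + 5 * ξ ^ 4) + (Y + ξ ^ 4) * (20 * ξ ^ 3))) /
        ((Y + ξ ^ 4) * (Y + 5 * ξ ^ 4)) ^ 2) (fun ξ => -Real.cos (Y * ξ + ξ ^ 5))
    · intro ξ hξ
      have hd : HasDerivAt (fun ξ : ℝ => Y + 5 * ξ ^ 4) (20 * ξ ^ 3) ξ := by
        refine (((hasDerivAt_pow 4 ξ).const_mul 5).const_add Y).congr_deriv ?_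
        norm_num; ring
      have hd1 : HasDerivAt (fun ξ : ℝ => Y + ξ ^ 4) (4 * ξ ^ 3) ξ := by
        refine ((hasDerivAt_pow 4 ξ).const_add Y).congr_deriv ?_
        norm_num
      have hd2 : HasDerivAt (fun ξ : ℝ => 4 * ξ ^ 3) (12 * ξ ^ 2) ξ := by
        refine ((hasDerivAt_pow 3 ξ).const_mul 4).congr_deriv ?_
        norm_num; ring
      exact hd2.div (hd1.mul hd) (by positivity)
    · intro ξ
      exact (aux_phase_deriv Y ξ).cos.neg.congr_deriv (by ring)
    · apply ContinuousOn.div (by fun_prop) (by fun_prop)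
      intro ξ hξ
      positivity
    · fun_prop
    · intro ξ hξ
      rw [abs_of_nonneg (by positivity), div_le_div_iff₀ (by positivity) (by positivity)]
      have e1 : ξ ^ 3 ≤ Y + ξ ^ 4 := by
        rcases le_total ξ 1 with h | h
        · have := pow_le_one₀ hξ h (n := 3)
          have : 0 ≤ ξ ^ 4 := by positivity
          linarith
        · have : ξ ^ 3 ≤ ξ ^ 4 := pow_le_pow_right₀ h (by norm_num)
          linarith
      have e2 : Y ≤ Y + 5 * ξ ^ 4 := by have : 0 ≤ ξ ^ 4 := by positivity
                                        linarith
      have := mul_le_mul e1 e2 hY0.le (by positivity)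
      linarith
    · intro ξ hξ
      have hA : 0 < Y + ξ ^ 4 := by positivity
      have hB : 0 < Y + 5 * ξ ^ 4 := by positivity
      have k1 : |12 * ξ ^ 2 * ((Y + ξ ^ 4) * (Y + 5 * ξ ^ 4)) -
        4 * ξ ^ 3 * (4 * ξ ^ 3 * (Y + 5 * ξ ^ 4) + (Y + ξ ^ 4) * (20 * ξ ^ 3))| ≤
          44 * ξ ^ 2 * ((Y + ξ ^ 4) * (Y + 5 * ξ ^ 4)) := by
        have p1 : 0 ≤ ξ ^ 2 * Y * (Y + 5 * ξ ^ 4) := by positivity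
        have p2 : 0 ≤ ξ ^ 2 * Y * (Y + ξ ^ 4) := by positivity
        have p3 : 0 ≤ ξ ^ 6 * (Y + 5 * ξ ^ 4) := by positivity
        have p4 : 0 ≤ ξ ^ 6 * (Y + ξ ^ 4) := by positivity
        have p5 : 0 ≤ ξ ^ 2 * ((Y + ξ ^ 4) * (Y + 5 * ξ ^ 4)) := by positivity
        rw [abs_le]; constructor <;> nlinarith
      rw [abs_div, abs_of_pos (by positivity : 0 < ((Y + ξ ^ 4) * (Y + 5 * ξ ^ 4)) ^ 2),
        div_mul_div_comm, mul_one]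
      calc _ ≤ 44 * ξ ^ 2 * ((Y + ξ ^ 4) * (Y + 5 * ξ ^ 4)) /
            ((Y + ξ ^ 4) * (Y + 5 * ξ ^ 4)) ^ 2 := by gcongr
        _ = 44 * ξ ^ 2 / ((Y + ξ ^ 4) * (Y + 5 * ξ ^ 4)) := by field_simp
        _ ≤ _ := by
          rw [div_le_div_iff₀ (by positivity) (by positivity)]
          have q1 : ξ ^ 2 * (1 + ξ ^ 2) * 2 ≤ 3 * (1 + ξ ^ 4) := by
            nlinarith [sq_nonneg (ξ ^ 2 - 1)]
          have q2 : Y * (1 + ξ ^ 4) ≤ (Y + ξ ^ 4) * (Y + 5 * ξ ^ 4) := by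
            have : 0 ≤ ξ ^ 4 := by positivity
            have r := mul_le_mul (show 1 + ξ ^ 4 ≤ Y + ξ ^ 4 by linarith)
              (show Y ≤ Y + 5 * ξ ^ 4 by linarith) hY0.le hA.le
            linarith
          have := mul_le_mul_of_nonneg_left q1 hY0.le
          linarith
    · intro ξ; rw [abs_neg]; exact Real.abs_cos_le_one _
  have h3 : ∫ ξ in (0:ℝ)..R, (4 * ξ ^ 3 / ((Y + ξ ^ 4) * (Y + 5 * ξ ^ 4))) *
      (Real.sin (Y * ξ + ξ ^ 5) * (Y + 5 * ξ ^ 4)) =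
      ∫ ξ in (0:ℝ)..R, 4 * ξ ^ 3 / (Y + ξ ^ 4) * Real.sin (Y * ξ + ξ ^ 5) := by
    apply integral_congr
    intro ξ hξ
    have hA : 0 < Y + ξ ^ 4 := by positivity
    have hB : 0 < Y + 5 * ξ ^ 4 := by positivity
    dsimp only
    field_simp
  rw [h3] at h2
  refine h2.trans (le_of_eq ?_)
  ring

lemma aux_inner3 (Y ξ : ℝ) (hY : 0 < Y) (hξ : 0 ≤ ξ) :
    ∫ y in (0:ℝ)..Y, Real.cos (y * ξ + ξ ^ 5) =
    Real.sinc (Y * ξ + ξ ^ 5) * (Y + 5 * ξ ^ 4) - Real.sinc (ξ ^ 5) * ξ ^ 4 -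
      4 * ξ ^ 3 / (Y + ξ ^ 4) * Real.sin (Y * ξ + ξ ^ 5) := by
  rcases hξ.eq_or_lt with rfl | hξ
  · simp
  rw [integral_eq_sub_of_hasDerivAt (f := fun y => Real.sin (y * ξ + ξ ^ 5) / ξ)]
  · have hA : 0 < Y + ξ ^ 4 := by positivity
    have e : Y * ξ + ξ ^ 5 = ξ * (Y + ξ ^ 4) := by ring
    rw [Real.sinc_of_ne_zero (by positivity), Real.sinc_of_ne_zero (by positivity)]
    simp only [zero_mul, zero_add]
    generalize hs : Real.sin (Y * ξ + ξ ^ 5) = s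
    rw [e]
    field_simp
    ring
  · intro y _
    refine ((((hasDerivAt_id y).mul_const ξ).add_const (ξ ^ 5)).sin.div_const ξ).congr_deriv ?_
    simp only [id]
    field_simp
  · apply Continuous.intervalIntegrable; fun_prop

lemma aux_double (Y R : ℝ) (hY : 0 < Y) (hR : 0 ≤ R) :
    ∫ y in (0:ℝ)..Y, ∫ ξ in (0:ℝ)..R, Real.cos (y * ξ + ξ ^ 5) =
    (∫ x in (0:ℝ)..(Y * R + R ^ 5), Real.sinc x) - (∫ x in (0:ℝ)..(R ^ 5), Real.sinc x) / 5 -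
      ∫ ξ in (0:ℝ)..R, 4 * ξ ^ 3 / (Y + ξ ^ 4) * Real.sin (Y * ξ + ξ ^ 5) := by
  have hsc := Real.continuous_sinc
  rw [aux_swap (fun y ξ => Real.cos (y * ξ + ξ ^ 5)) (by fun_prop)]
  have c3 : Continuous (fun ξ : ℝ => 4 * ξ ^ 3 / (Y + ξ ^ 4) * Real.sin (Y * ξ + ξ ^ 5)) :=
    (Continuous.div (by fun_prop) (by fun_prop) (fun x => by positivity)).mul (by fun_prop)
  have h1 : ∫ ξ in (0:ℝ)..R, Real.sinc (Y * ξ + ξ ^ 5) * (Y + 5 * ξ ^ 4) =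
      ∫ x in (0:ℝ)..(Y * R + R ^ 5), Real.sinc x := by
    have := integral_comp_mul_deriv (a := 0) (b := R) (f := fun ξ : ℝ => Y * ξ + ξ ^ 5)
      (f' := fun ξ => Y + 5 * ξ ^ 4) (g := Real.sinc) (fun ξ _ => aux_phase_deriv Y ξ)
      (by fun_prop) hsc
    simpa using this
  have h2 : ∫ ξ in (0:ℝ)..R, Real.sinc (ξ ^ 5) * ξ ^ 4 =
      (∫ x in (0:ℝ)..(R ^ 5), Real.sinc x) / 5 := by
    have := integral_comp_mul_deriv (a := 0) (b := R) (f := fun ξ : ℝ => ξ ^ 5)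
      (f' := fun ξ => 5 * ξ ^ 4) (g := Real.sinc)
      (fun ξ _ => (hasDerivAt_pow 5 ξ).congr_deriv (by norm_num))
      (by fun_prop) hsc
    simp only [Function.comp] at this
    rw [show (0:ℝ) ^ 5 = 0 by norm_num] at this
    rw [← this, eq_div_iff (by norm_num), ← intervalIntegral.integral_mul_const]
    congr 1; ext ξ; ring
  rw [← h1, ← h2, ← integral_sub, ← integral_sub]
  · apply integral_congr
    intro ξ hξ
    rw [Set.uIcc_of_le hR] at hξ
    exact aux_inner3 Y ξ hY hξ.1
  all_goals apply Continuous.intervalIntegrable; fun_prop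

lemma aux_cplx (x R : ℝ) :
    (1 / (2 * (Real.pi : ℂ))) *
      ∫ ξ in (-R)..R, Complex.exp (Complex.I * ((x : ℂ) * (ξ : ℂ) + (ξ : ℂ)^5)) =
    ((1 / Real.pi * ∫ ξ in (0:ℝ)..R, Real.cos (x * ξ + ξ ^ 5) : ℝ) : ℂ) := by
  have hc : Continuous (fun ξ : ℝ =>
      Complex.exp (Complex.I * ((x : ℂ) * (ξ : ℂ) + (ξ : ℂ)^5))) := by fun_prop
  have h1 : ∫ ξ in (-R)..(0:ℝ), Complex.exp (Complex.I * ((x : ℂ) * (ξ : ℂ) + (ξ : ℂ)^5)) =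
      ∫ ξ in (0:ℝ)..R, Complex.exp (-(Complex.I * ((x : ℂ) * (ξ : ℂ) + (ξ : ℂ)^5))) := by
    have := integral_comp_neg (a := 0) (b := R)
      (fun ξ : ℝ => Complex.exp (Complex.I * ((x : ℂ) * (ξ : ℂ) + (ξ : ℂ)^5)))
    rw [neg_zero] at this
    rw [← this]
    congr 1; ext ξ; congr 1; push_cast; ring
  rw [← integral_add_adjacent_intervals (hc.intervalIntegrable (-R) 0) (hc.intervalIntegrable 0 R),
    h1, ← integral_add (Continuous.intervalIntegrable (by fun_prop) _ _)
      (hc.intervalIntegrable _ _)]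
  have h2 : ∀ ξ : ℝ, Complex.exp (-(Complex.I * ((x : ℂ) * (ξ : ℂ) + (ξ : ℂ)^5))) +
      Complex.exp (Complex.I * ((x : ℂ) * (ξ : ℂ) + (ξ : ℂ)^5)) =
      2 * ((Real.cos (x * ξ + ξ ^ 5) : ℝ) : ℂ) := by
    intro ξ
    push_cast
    rw [Complex.two_cos, add_comm]
    congr 2 <;> ring
  simp only [h2]
  rw [intervalIntegral.integral_const_mul, intervalIntegral.integral_ofReal]
  push_cast
  have : (Real.pi : ℂ) ≠ 0 := by exact_mod_cast Real.pi_ne_zero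
  field_simp

/-- The improper integral of the oscillatory kernel `B` over `(0,∞)` equals `2/5`. -/
theorem oscillatory_kernel_halfline_integral
    (B : ℝ → ℂ)
    (hB : ∀ x : ℝ, Tendsto
      (fun R : ℝ => (1 / (2 * (Real.pi : ℂ))) *
        ∫ ξ in (-R)..R, Complex.exp (Complex.I * ((x : ℂ) * (ξ : ℂ) + (ξ : ℂ)^5)))
      atTop (nhds (B x))) :
    Tendsto (fun R : ℝ => ∫ y in (0:ℝ)..R, B y) atTop (nhds ((2/5 : ℂ))) := by
  simp only [aux_cplx] at hB
  have key : ∀ Y : ℝ, 1 ≤ Y → ‖(∫ y in (0:ℝ)..Y, B y) - (2 / 5 : ℂ)‖ ≤ 140 / Y := by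
    intro Y hY
    have hY0 : 0 < Y := by linarith
    have hlim : Tendsto (fun R : ℝ => ∫ y in (0:ℝ)..Y,
        ((1 / Real.pi * ∫ ξ in (0:ℝ)..R, Real.cos (y * ξ + ξ ^ 5) : ℝ) : ℂ)) atTop
        (nhds (∫ y in (0:ℝ)..Y, B y)) := by
      apply intervalIntegral.tendsto_integral_filter_of_dominated_convergence (fun _ => 7)
      · refine Eventually.of_forall fun R => Continuous.aestronglyMeasurable ?_
        apply Complex.continuous_ofReal.comp
        apply continuous_const.mul
        apply intervalIntegral.continuous_parametric_intervalIntegral_of_continuous' (by fun_prop)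
      · filter_upwards [eventually_ge_atTop 1] with R hR
        refine Eventually.of_forall fun y hy => ?_
        rw [Set.uIoc_of_le hY0.le] at hy
        rw [Complex.norm_real, Real.norm_eq_abs, abs_mul, abs_of_pos (by positivity)]
        have h1 := aux_bound y R hy.1.le hR
        have h2 : 1 / Real.pi ≤ 1 := by
          rw [div_le_one Real.pi_pos]; linarith [Real.pi_gt_three]
        calc _ ≤ 1 * (7:ℝ) := mul_le_mul h2 h1 (abs_nonneg _) zero_le_one
          _ = 7 := one_mul _
      · exact intervalIntegrable_const
      · exact Eventually.of_forall fun y _ => hB y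
    have hR5 : Tendsto (fun R : ℝ => R ^ 5) atTop atTop := tendsto_pow_atTop (by norm_num)
    have hYR : Tendsto (fun R : ℝ => Y * R + R ^ 5) atTop atTop :=
      (tendsto_id.const_mul_atTop hY0).atTop_add_atTop hR5
    have hD : Tendsto (fun R : ℝ => 1 / Real.pi * ((∫ x in (0:ℝ)..(Y * R + R ^ 5), Real.sinc x) -
        (∫ x in (0:ℝ)..(R ^ 5), Real.sinc x) / 5)) atTop (nhds (2 / 5)) := by
      have := ((aux_dirichlet.comp hYR).sub ((aux_dirichlet.comp hR5).div_const 5)).const_mul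
        (1 / Real.pi)
      have e : 1 / Real.pi * (Real.pi / 2 - Real.pi / 2 / 5) = 2 / 5 := by
        have := Real.pi_ne_zero
        field_simp
        norm_num
      rw [e] at this
      exact this
    have hD' := (Complex.continuous_ofReal.tendsto _).comp hD
    have hdiff := (hlim.sub hD').norm
    have e : (((2 / 5 : ℝ)) : ℂ) = 2 / 5 := by push_cast; rfl
    rw [e] at hdiff
    refine le_of_tendsto hdiff ?_
    filter_upwards [eventually_ge_atTop 0] with R hR
    rw [intervalIntegral.integral_ofReal, intervalIntegral.integral_const_mul,
      aux_double Y R hY0 hR]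
    simp only [Function.comp]
    rw [← Complex.ofReal_sub, Complex.norm_real, ← mul_sub, Real.norm_eq_abs, abs_mul,
      abs_of_pos (by positivity : 0 < 1 / Real.pi), sub_sub_cancel_left, abs_neg]
    have h2 : 1 / Real.pi ≤ 1 := by
      rw [div_le_one Real.pi_pos]; linarith [Real.pi_gt_three]
    calc _ ≤ 1 * (140 / Y) := mul_le_mul h2 (aux_rem Y R hY hR) (abs_nonneg _) zero_le_one
      _ = _ := one_mul _
  rw [tendsto_iff_norm_sub_tendsto_zero]
  refine squeeze_zero' (Eventually.of_forall fun _ => norm_nonneg _) ?_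
    ((tendsto_const_nhds (x := (140:ℝ))).div_atTop tendsto_id)
  filter_upwards [eventually_ge_atTop 1] with R hR
  exact key R hR
end

section
/- Let B(x) = (1/2π)∫e^{ixξ}e^{iξ⁵}dξ. For λ ∈ ℂ with 0 < Re λ < 3/8, ∫₀^∞ x^{λ−1}B(−x)dx = Γ(λ)Γ((1−λ)/5)·cos((1−6λ)π/10)/(5π). -/
open Filter intervalIntegral MeasureTheory

lemma c_facts {c : ℂ} (hc : c = Complex.I ∨ c = -Complex.I) : ‖c‖ = 1 ∧ c.re = 0 ∧ c ≠ 0 ∧ c * c = -1 := by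
  rcases hc with rfl | rfl <;> simp

lemma norm_exp_c {c : ℂ} (hc : c = Complex.I ∨ c = -Complex.I) (t : ℝ) :
    ‖Complex.exp (c * t)‖ = 1 := by
  rw [Complex.norm_exp]; simp [(c_facts hc).2.1]

lemma first_deriv {c : ℂ} (hc : c = Complex.I ∨ c = -Complex.I) (x u v μ : ℝ) (hu : 0 ≤ u)
    (huv : u ≤ v) (hμ : 0 < μ) (h : ∀ ξ ∈ Set.Icc u v, μ ≤ |5 * ξ^4 - x|) :
    ‖∫ ξ in u..v, Complex.exp (c * ((ξ^5 - x * ξ : ℝ) : ℂ))‖ ≤ 4 / μ := by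
  obtain ⟨h1, h2, h3, h4⟩ := c_facts hc
  have hne : ∀ ξ ∈ Set.Icc u v, 5 * ξ^4 - x ≠ 0 := fun ξ hξ h0 => by
    have := h ξ hξ; rw [h0] at this; simp at this; linarith
  have hneC : ∀ ξ ∈ Set.Icc u v, ((5 * ξ^4 - x : ℝ) : ℂ) ≠ 0 := fun ξ hξ => by
    exact_mod_cast hne ξ hξ
  have hp : ∀ ξ : ℝ, HasDerivAt (fun ξ : ℝ => 5 * ξ^4 - x) (20 * ξ^3) ξ := fun ξ => by
    have := ((hasDerivAt_pow 4 ξ).const_mul 5).sub_const x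
    refine this.congr_deriv ?_
    norm_num; ring
  have hph : ∀ ξ : ℝ, HasDerivAt (fun ξ : ℝ => ξ^5 - x * ξ) (5 * ξ^4 - x) ξ := fun ξ => by
    have := (hasDerivAt_pow 5 ξ).sub ((hasDerivAt_id ξ).const_mul x)
    refine this.congr_deriv ?_
    norm_num
  have hI : Set.uIcc u v = Set.Icc u v := Set.uIcc_of_le huv
  set E : ℝ → ℂ := fun ξ => Complex.exp (c * ((ξ^5 - x * ξ : ℝ) : ℂ)) with hE
  have hEn : ∀ ξ, ‖E ξ‖ = 1 := fun ξ => norm_exp_c hc _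
  have hEc : Continuous E := by simp only [hE]; fun_prop
  set W : ℝ → ℝ := fun ξ => 20 * ξ^3 / (5 * ξ^4 - x)^2 with hW
  have hWc : ContinuousOn W (Set.Icc u v) := by
    apply ContinuousOn.div (by fun_prop) (by fun_prop)
    intro ξ hξ; exact pow_ne_zero 2 (hne ξ hξ)
  have hWi : IntervalIntegrable W volume u v := (hI ▸ hWc).intervalIntegrable
  have hWint : ∫ ξ in u..v, W ξ = -(5*v^4-x)⁻¹ - -(5*u^4-x)⁻¹ := by
    apply integral_eq_sub_of_hasDerivAt (f := fun ξ => -(5*ξ^4-x)⁻¹) _ hWi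
    intro ξ hξ; rw [hI] at hξ
    refine ((hp ξ).inv (hne ξ hξ)).neg.congr_deriv ?_
    simp only [hW]; ring
  have hG : ∫ ξ in u..v, (E ξ - c⁻¹ * E ξ * W ξ) =
      c⁻¹ * E v * ((5*v^4-x)⁻¹ : ℝ) - c⁻¹ * E u * ((5*u^4-x)⁻¹ : ℝ) := by
    apply integral_eq_sub_of_hasDerivAt (f := fun ξ => c⁻¹ * E ξ * ((5*ξ^4-x)⁻¹ : ℝ))
    · intro ξ hξ; rw [hI] at hξ
      have e1 := (((hph ξ).ofReal_comp).const_mul c).cexp.const_mul c⁻¹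
      have e2 := ((hp ξ).inv (hne ξ hξ)).ofReal_comp
      refine (e1.mul e2).congr_deriv ?_
      have := hneC ξ hξ
      simp only [hE, hW, Pi.inv_apply]
      generalize Complex.exp _ = z
      push_cast at this ⊢
      field_simp
      ring
    · apply ContinuousOn.intervalIntegrable
      rw [hI]
      apply hEc.continuousOn.sub
      exact (hEc.continuousOn.const_smul c⁻¹).mul (Complex.continuous_ofReal.comp_continuousOn hWc)
  have hii : IntervalIntegrable (fun ξ => c⁻¹ * E ξ * W ξ) volume u v := by
    apply ContinuousOn.intervalIntegrable
    rw [hI]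
    exact (hEc.continuousOn.const_smul c⁻¹).mul (Complex.continuous_ofReal.comp_continuousOn hWc)
  rw [integral_sub (hEc.intervalIntegrable _ _) hii] at hG
  have hb : ‖∫ ξ in u..v, c⁻¹ * E ξ * W ξ‖ ≤ ∫ ξ in u..v, W ξ := by
    apply intervalIntegral.norm_integral_le_of_norm_le huv _ hWi
    refine Eventually.of_forall fun ξ hξ => ?_
    rw [norm_mul, norm_mul, norm_inv, h1, hEn, Complex.norm_real, Real.norm_of_nonneg]
    · simp
    · have : 0 ≤ ξ := hu.trans hξ.1.le
      positivity
  rw [hWint] at hb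
  have bd : ∀ ξ ∈ Set.Icc u v, |(5*ξ^4-x)⁻¹| ≤ 1/μ := fun ξ hξ => by
    rw [abs_inv, ← one_div]; exact one_div_le_one_div_of_le hμ (h ξ hξ)
  have bv := bd v ⟨huv, le_rfl⟩
  have bu := bd u ⟨le_rfl, huv⟩
  rw [sub_eq_iff_eq_add] at hG
  rw [hG]
  have n1 : ‖c⁻¹ * E v * ((5*v^4-x)⁻¹ : ℝ)‖ ≤ 1/μ := by
    rw [norm_mul, norm_mul, norm_inv, h1, hEn, Complex.norm_real]; simpa using bv
  have n2 : ‖c⁻¹ * E u * ((5*u^4-x)⁻¹ : ℝ)‖ ≤ 1/μ := by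
    rw [norm_mul, norm_mul, norm_inv, h1, hEn, Complex.norm_real]; simpa using bu
  have := norm_add_le (c⁻¹ * E v * ((5*v^4-x)⁻¹ : ℝ) - c⁻¹ * E u * ((5*u^4-x)⁻¹ : ℝ)) (∫ ξ in u..v, c⁻¹ * E ξ * W ξ)
  have := norm_sub_le (c⁻¹ * E v * ((5*v^4-x)⁻¹ : ℝ)) (c⁻¹ * E u * ((5*u^4-x)⁻¹ : ℝ))
  have e : 4/μ = 1/μ+1/μ+1/μ+1/μ := by ring
  rw [e]
  linarith [abs_le.1 bv, abs_le.1 bu]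

noncomputable def KK (c : ℂ) (R x : ℝ) : ℂ := ∫ ξ in (0:ℝ)..R, Complex.exp (c * ((ξ^5 - x * ξ : ℝ) : ℂ))

lemma triv_bd {c : ℂ} (hc : c = Complex.I ∨ c = -Complex.I) (x u v : ℝ) (huv : u ≤ v) :
    ‖∫ ξ in u..v, Complex.exp (c * ((ξ^5 - x * ξ : ℝ) : ℂ))‖ ≤ v - u := by
  have := intervalIntegral.norm_integral_le_of_norm_le_const (a := u) (b := v) (C := 1)
    (f := fun ξ : ℝ => Complex.exp (c * ((ξ^5 - x * ξ : ℝ) : ℂ))) (fun ξ _ => (norm_exp_c hc _).le)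
  rwa [one_mul, abs_of_nonneg (by linarith)] at this

lemma ii {c : ℂ} (x u v : ℝ) : IntervalIntegrable (fun ξ : ℝ => Complex.exp (c * ((ξ^5 - x * ξ : ℝ) : ℂ))) volume u v := by
  apply Continuous.intervalIntegrable; fun_prop

lemma KK_small {c : ℂ} (hc : c = Complex.I ∨ c = -Complex.I) (R x : ℝ) (hR : 0 ≤ R)
    (hx : x ≤ 1) : ‖KK c R x‖ ≤ 4 := by
  unfold KK
  have hm : 0 ≤ min R 1 := le_min hR zero_le_one
  rw [← intervalIntegral.integral_add_adjacent_intervals (ii x 0 (min R 1)) (ii x (min R 1) R)]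
  refine (norm_add_le _ _).trans ?_
  have h1 := triv_bd hc x 0 (min R 1) hm
  have h2 : ‖∫ ξ in (min R 1)..R, Complex.exp (c * ((ξ^5 - x * ξ : ℝ) : ℂ))‖ ≤ 4 / 4 := by
    rcases le_total R 1 with h | h
    · rw [min_eq_left h]; simp
    · rw [min_eq_right h]
      apply first_deriv hc _ _ _ _ zero_le_one h (by norm_num)
      intro ξ hξ
      have : 1 ≤ ξ^4 := one_le_pow₀ hξ.1
      rw [abs_of_nonneg] <;> linarith
  linarith [min_le_right R 1]

lemma KK_a {c : ℂ} (hc : c = Complex.I ∨ c = -Complex.I) (R a δ : ℝ) (hR : 0 ≤ R)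
    (ha : 0 < a) (hδ : 0 < δ) : ‖KK c R (5 * a^4)‖ ≤ 2 * δ + 8 / (5 * δ * a^3) := by
  unfold KK
  set p := min R (max 0 (a - δ)) with hp
  set q := min R (a + δ) with hq
  have hp0 : 0 ≤ p := le_min hR (le_max_left _ _)
  have hpq : p ≤ q := min_le_min le_rfl (max_le (by linarith) (by linarith))
  have hqR : q ≤ R := min_le_left _ _
  have hqp : q - p ≤ 2 * δ := by
    rcases le_total R (max 0 (a - δ)) with h | h
    · rw [hp, min_eq_left h]; linarith
    · rw [hp, min_eq_right h]; linarith [min_le_right R (a+δ), le_max_right 0 (a - δ)]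
  have hμ : 0 < 5 * δ * a^3 := by positivity
  have key : ∀ ξ, 0 ≤ ξ → δ ≤ |ξ - a| → 5 * δ * a^3 ≤ |5 * ξ^4 - 5 * a^4| := by
    intro ξ h0 h1
    have : 5 * ξ^4 - 5 * a^4 = 5 * ((ξ - a) * ((ξ + a) * (ξ^2 + a^2))) := by ring
    rw [this, abs_mul, abs_mul, abs_of_pos (by norm_num : (0:ℝ) < 5), mul_assoc]
    have : a^3 ≤ |(ξ + a) * (ξ^2 + a^2)| := by
      rw [abs_of_nonneg (by positivity)]
      have : 0 ≤ ξ^3 + ξ * a^2 + a * ξ^2 := by positivity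
      nlinarith
    have : δ * a^3 ≤ |ξ - a| * |(ξ + a) * (ξ^2 + a^2)| := by gcongr
    linarith
  rw [← intervalIntegral.integral_add_adjacent_intervals (ii _ 0 p) (ii _ p R),
    ← intervalIntegral.integral_add_adjacent_intervals (ii _ p q) (ii _ q R)]
  have h1 : ‖∫ ξ in (0:ℝ)..p, Complex.exp (c * ((ξ^5 - 5 * a^4 * ξ : ℝ) : ℂ))‖ ≤ 4 / (5 * δ * a^3) := by
    rcases le_total (a - δ) 0 with h | h
    · have : p = 0 := by rw [hp, max_eq_left h, min_eq_right hR]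
      rw [this]; simp; positivity
    · apply first_deriv hc _ _ _ _ le_rfl hp0 hμ
      intro ξ hξ
      apply key ξ hξ.1
      have : ξ ≤ a - δ := hξ.2.trans (by rw [hp, max_eq_right h]; exact min_le_right _ _)
      rw [abs_sub_comm, abs_of_nonneg] <;> linarith
  have h2 := triv_bd hc (5*a^4) p q hpq
  have h3 : ‖∫ ξ in q..R, Complex.exp (c * ((ξ^5 - 5 * a^4 * ξ : ℝ) : ℂ))‖ ≤ 4 / (5 * δ * a^3) := by
    rcases le_total R (a + δ) with h | h
    · have : q = R := min_eq_left h
      rw [this]; simp; positivity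
    · apply first_deriv hc _ _ _ _ (hp0.trans hpq) hqR hμ
      intro ξ hξ
      apply key ξ ((hp0.trans hpq).trans hξ.1)
      have : a + δ ≤ ξ := (min_eq_right h : q = a + δ) ▸ hξ.1
      rw [abs_of_nonneg] <;> linarith
  have e : 8 / (5 * δ * a^3) = 4 / (5 * δ * a^3) + 4 / (5 * δ * a^3) := by ring
  refine (norm_add_le _ _).trans ?_
  refine (add_le_add le_rfl (norm_add_le _ _)).trans ?_
  linarith

lemma KK_large {c : ℂ} (hc : c = Complex.I ∨ c = -Complex.I) (R x : ℝ) (hR : 0 ≤ R)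
    (hx : 0 < x) : ‖KK c R x‖ ≤ 20 * x^(-(3/8) : ℝ) := by
  set y := x / 5 with hy
  have hy0 : 0 < y := by positivity
  have ha4 : 5 * (y^(1/4 : ℝ))^4 = x := by
    rw [← Real.rpow_mul_natCast hy0.le]; norm_num [hy]; ring
  have := KK_a hc R (y^(1/4 : ℝ)) (y^(-(3/8) : ℝ)) hR (by positivity) (by positivity)
  rw [ha4] at this
  have e : 8 / (5 * y^(-(3/8) : ℝ) * (y^(1/4 : ℝ))^3) = 8/5 * y^(-(3/8) : ℝ) := by
    rw [← Real.rpow_mul_natCast hy0.le, mul_assoc, ← Real.rpow_add hy0, div_mul_eq_div_div,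
      div_eq_mul_inv (8/5), ← Real.rpow_neg hy0.le]
    norm_num
  rw [e] at this
  have e2 : y^(-(3/8) : ℝ) ≤ 5 * x^(-(3/8) : ℝ) := by
    rw [hy, Real.div_rpow hx.le (by norm_num), Real.rpow_neg (by norm_num : (0:ℝ) ≤ 5), div_inv_eq_mul, mul_comm]
    gcongr
    calc (5:ℝ)^(3/8 : ℝ) ≤ 5^(1:ℝ) := Real.rpow_le_rpow_of_exponent_le (by norm_num) (by norm_num)
      _ = 5 := by simp
  have : 0 < x^(-(3/8) : ℝ) := by positivity
  linarith

lemma gi_norm (a r : ℂ) {t : ℝ} (ht : 0 < t) :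
    ‖(t:ℂ)^(a-1) * Complex.exp (-(r*t))‖ = t^(a.re-1) * Real.exp (-r.re * t) := by
  rw [norm_mul, Complex.norm_cpow_eq_rpow_re_of_pos ht, Complex.norm_exp]
  simp

lemma gi_cont (a r : ℂ) : ContinuousOn (fun t : ℝ => (t:ℂ)^(a-1) * Complex.exp (-(r*t))) (Set.Ioi 0) := by
  apply ContinuousOn.mul
  · intro t ht
    apply ContinuousAt.continuousWithinAt
    exact (continuousAt_cpow_const (Complex.ofReal_mem_slitPlane.2 ht)).comp (f := fun t : ℝ => (t:ℂ)) (by fun_prop)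
  · fun_prop

lemma gi_real {s b : ℝ} (hs : -1 < s) (hb : 0 < b) :
    IntegrableOn (fun t : ℝ => t^s * Real.exp (-b * t)) (Set.Ioi 0) := by
  have := integrableOn_rpow_mul_exp_neg_mul_rpow hs one_pos hb
  simpa using this

lemma gi_int {a r : ℂ} (ha : 0 < a.re) (hr : 0 < r.re) :
    IntegrableOn (fun t : ℝ => (t:ℂ)^(a-1) * Complex.exp (-(r*t))) (Set.Ioi 0) := by
  refine Integrable.mono' (gi_real (s := a.re - 1) (by linarith) hr)
    ((gi_cont a r).aestronglyMeasurable measurableSet_Ioi) ?_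
  refine (ae_restrict_iff' measurableSet_Ioi).2 (Eventually.of_forall fun t ht => ?_)
  exact (gi_norm a r ht).le

lemma gi_deriv {a r : ℂ} (ha : 0 < a.re) (hr : 0 < r.re) :
    DifferentiableAt ℂ (fun r : ℂ => ∫ t in Set.Ioi (0:ℝ), (t:ℂ)^(a-1) * Complex.exp (-(r*t))) r := by
  have hs : {z : ℂ | r.re/2 < z.re} ∈ nhds r :=
    (isOpen_lt continuous_const Complex.continuous_re).mem_nhds (by simp; linarith)
  refine (hasDerivAt_integral_of_dominated_loc_of_deriv_le (μ := volume.restrict (Set.Ioi (0:ℝ)))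
    (F := fun (r : ℂ) (t : ℝ) => (t:ℂ)^(a-1) * Complex.exp (-(r*t)))
    (F' := fun (r : ℂ) (t : ℝ) => (t:ℂ)^(a-1) * (Complex.exp (-(r*t)) * (-t)))
    (bound := fun t : ℝ => t^a.re * Real.exp (-(r.re/2) * t)) hs ?_ (gi_int ha hr) ?_ ?_ ?_ ?_).2.differentiableAt
  · exact Eventually.of_forall fun z => (gi_cont a z).aestronglyMeasurable measurableSet_Ioi
  · apply ContinuousOn.aestronglyMeasurable _ measurableSet_Ioi
    have := (gi_cont a r).mul (Complex.continuous_ofReal.neg.continuousOn (s := Set.Ioi 0))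
    refine this.congr fun t _ => ?_
    simp only [Pi.mul_apply, Pi.neg_apply]; ring
  · refine (ae_restrict_iff' measurableSet_Ioi).2 (Eventually.of_forall fun t ht z hz => ?_)
    have ht' : 0 < t := ht
    have hz' : r.re/2 < z.re := hz
    rw [← mul_assoc, norm_mul, gi_norm a z ht, norm_neg, Complex.norm_real, Real.norm_of_nonneg ht'.le]
    have : t^a.re = t^(a.re-1) * t := by
      rw [← Real.rpow_add_one ht'.ne']; simp
    rw [this]
    have : Real.exp (-z.re * t) ≤ Real.exp (-(r.re/2) * t) := by
      apply Real.exp_le_exp.2; nlinarith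
    have h0 : 0 ≤ t^(a.re-1) * t := by positivity
    nlinarith
  · exact gi_real (by linarith) (by linarith)
  · refine Eventually.of_forall fun t z hz => ?_
    have := ((((hasDerivAt_id z).mul_const (t:ℂ)).neg).cexp).const_mul ((t:ℂ)^(a-1))
    refine this.congr_deriv ?_
    simp

lemma gi_val {a r : ℂ} (ha : 0 < a.re) (hr : 0 < r.re) :
    ∫ t in Set.Ioi (0:ℝ), (t:ℂ)^(a-1) * Complex.exp (-(r*t)) = (1/r)^a * Complex.Gamma a := by
  have hU : IsOpen {z : ℂ | 0 < z.re} := isOpen_lt continuous_const Complex.continuous_re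
  have hf : AnalyticOnNhd ℂ (fun r : ℂ => ∫ t in Set.Ioi (0:ℝ), (t:ℂ)^(a-1) * Complex.exp (-(r*t))) {z : ℂ | 0 < z.re} :=
    DifferentiableOn.analyticOnNhd (fun z hz => (gi_deriv ha hz).differentiableWithinAt) hU
  have hg : AnalyticOnNhd ℂ (fun r : ℂ => (1/r)^a * Complex.Gamma a) {z : ℂ | 0 < z.re} := by
    apply DifferentiableOn.analyticOnNhd _ hU
    intro z hz
    have hz0 : 0 < z.re := hz
    apply DifferentiableAt.differentiableWithinAt
    have hzn : z ≠ 0 := by rintro rfl; simp at hz0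
    apply DifferentiableAt.mul_const
    apply DifferentiableAt.cpow_const
    · exact (differentiableAt_const 1).div differentiableAt_id hzn
    · left
      rw [one_div, Complex.inv_re]
      exact div_pos hz0 (Complex.normSq_pos.2 hzn)
  refine hf.eqOn_of_preconnected_of_frequently_eq hg ?_ (z₀ := 1) (by simp) ?_ hr
  · exact (convex_halfSpace_re_gt 0).isPreconnected
  · have ht : Tendsto (fun x : ℝ => (x:ℂ)) (nhdsWithin 1 {1}ᶜ) (nhdsWithin 1 {1}ᶜ) := by
      apply tendsto_nhdsWithin_of_tendsto_nhds_of_eventually_within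
      · exact (Complex.continuous_ofReal.tendsto' 1 1 (by simp)).mono_left nhdsWithin_le_nhds
      · filter_upwards [self_mem_nhdsWithin] with x hx
        simpa using hx
    apply ht.frequently
    apply Eventually.frequently
    have : ∀ᶠ x : ℝ in nhdsWithin 1 {1}ᶜ, 0 < x := nhdsWithin_le_nhds (lt_mem_nhds zero_lt_one)
    filter_upwards [this] with x hx
    exact Complex.integral_cpow_mul_exp_neg_mul_Ioi ha hx

lemma tail_bd {s r : ℂ} (hs1 : s.re < 1) (hr : 0 ≤ r.re) (hr1 : 1 ≤ ‖r‖)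
    {T T' : ℝ} (hT : 0 < T) (hTT : T ≤ T') :
    ‖∫ u in T..T', (u:ℂ)^(s-1) * Complex.exp (-(r*u))‖ ≤
      (2 + ‖s-1‖ / (1 - s.re)) * T^(s.re-1) := by
  have hr0 : r ≠ 0 := by rintro rfl; norm_num at hr1
  have hI : Set.uIcc T T' = Set.Icc T T' := Set.uIcc_of_le hTT
  have hsub : Set.Icc T T' ⊆ Set.Ioi 0 := fun u hu => lt_of_lt_of_le hT hu.1
  have hcont : ∀ a : ℂ, IntervalIntegrable (fun u : ℝ => (u:ℂ)^(a-1) * Complex.exp (-(r*u))) volume T T' := by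
    intro a
    apply ContinuousOn.intervalIntegrable
    rw [hI]; exact (gi_cont a r).mono hsub
  have hn : ∀ (a : ℂ) (u : ℝ), 0 < u → ‖(u:ℂ)^(a-1) * Complex.exp (-(r*u))‖ ≤ u^(a.re-1) := by
    intro a u hu
    rw [gi_norm a r hu]
    have : Real.exp (-r.re * u) ≤ 1 := Real.exp_le_one_iff.2 (by nlinarith)
    have : 0 ≤ u^(a.re-1) := by positivity
    nlinarith
  have hri : ‖r⁻¹‖ ≤ 1 := by rw [norm_inv]; exact inv_le_one_of_one_le₀ hr1
  have hG : ∫ u in T..T', ((u:ℂ)^(s-1) * Complex.exp (-(r*u)) -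
      r⁻¹ * (s-1) * ((u:ℂ)^(s-1-1) * Complex.exp (-(r*u)))) =
      -r⁻¹ * ((T':ℂ)^(s-1) * Complex.exp (-(r*T'))) - -r⁻¹ * ((T:ℂ)^(s-1) * Complex.exp (-(r*T))) := by
    apply integral_eq_sub_of_hasDerivAt (f := fun u : ℝ => -r⁻¹ * ((u:ℂ)^(s-1) * Complex.exp (-(r*u))))
    · intro u hu; rw [hI] at hu
      have hu0 : 0 < u := hsub hu
      have e1 : HasDerivAt (fun u : ℝ => (u:ℂ)^(s-1)) ((s-1) * (u:ℂ)^(s-1-1)) u := by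
        have := (Complex.hasStrictDerivAt_cpow_const (c := s-1) (Complex.ofReal_mem_slitPlane.2 hu0)).hasDerivAt.comp_ofReal
        exact this
      have e2 : HasDerivAt (fun u : ℝ => Complex.exp (-(r*u))) (Complex.exp (-(r*u)) * (-r)) u := by
        have := ((((hasDerivAt_id (u:ℂ)).const_mul r).neg).cexp).comp_ofReal
        refine this.congr_deriv ?_
        simp
      refine ((e1.mul e2).const_mul (-r⁻¹)).congr_deriv ?_
      field_simp
      ring
    · exact (hcont s).sub ((hcont (s-1)).const_mul _)
  rw [integral_sub (hcont s) ((hcont (s-1)).const_mul _), intervalIntegral.integral_const_mul, sub_eq_iff_eq_add] at hG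
  have hIi : IntervalIntegrable (fun u : ℝ => u^(s.re-1-1)) volume T T' := by
    apply ContinuousOn.intervalIntegrable
    rw [hI]
    exact continuousOn_id.rpow_const (fun u hu => Or.inl (hsub hu).ne')
  have hb : ‖∫ u in T..T', ((u:ℂ)^(s-1-1) * Complex.exp (-(r*u)))‖ ≤ T^(s.re-1) / (1 - s.re) := by
    refine (intervalIntegral.norm_integral_le_of_norm_le hTT (Eventually.of_forall fun u hu => hn (s-1) u (hT.trans hu.1)) (by simpa using hIi)).trans ?_
    have : ∫ u in T..T', u^((s-1).re-1) = (T'^(s.re-1) - T^(s.re-1)) / (s.re - 1) := by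
      simp only [Complex.sub_re, Complex.one_re]
      rw [integral_rpow]
      · simp
      · right
        refine ⟨by intro h; linarith, fun h => ?_⟩
        rw [hI] at h; exact absurd (hsub h) Set.self_notMem_Ioi
    rw [this, ← neg_div_neg_eq, neg_sub, neg_sub]
    apply div_le_div_of_nonneg_right _ (by linarith)
    have : 0 ≤ T'^(s.re-1) := Real.rpow_nonneg (hT.le.trans hTT) _
    linarith
  rw [hG]
  have hT'T : T'^(s.re-1) ≤ T^(s.re-1) := Real.rpow_le_rpow_of_nonpos hT hTT (by linarith)
  have a1 : ‖-r⁻¹ * ((T':ℂ)^(s-1) * Complex.exp (-(r*T')))‖ ≤ T^(s.re-1) := by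
    rw [norm_mul, norm_neg]
    exact (mul_le_of_le_one_left (norm_nonneg _) hri).trans ((hn s T' (hT.trans_le hTT)).trans hT'T)
  have a2 : ‖-r⁻¹ * ((T:ℂ)^(s-1) * Complex.exp (-(r*T)))‖ ≤ T^(s.re-1) := by
    rw [norm_mul, norm_neg]
    exact (mul_le_of_le_one_left (norm_nonneg _) hri).trans (hn s T hT)
  have a3 : ‖r⁻¹ * (s-1) * ∫ u in T..T', ((u:ℂ)^(s-1-1) * Complex.exp (-(r*u)))‖ ≤ ‖s-1‖ * (T^(s.re-1) / (1 - s.re)) := by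
    rw [norm_mul, norm_mul]
    gcongr
    exact mul_le_of_le_one_left (norm_nonneg _) hri
  have e : (2 + ‖s-1‖ / (1 - s.re)) * T^(s.re-1) = T^(s.re-1) + T^(s.re-1) + ‖s-1‖ * (T^(s.re-1) / (1 - s.re)) := by ring
  rw [e]
  exact (norm_add_le _ _).trans (add_le_add ((norm_sub_le _ _).trans (add_le_add a1 a2)) a3)

lemma slit_c {c : ℂ} (hc : c = Complex.I ∨ c = -Complex.I) {x : ℝ} (hx : 0 < x) :
    1 / (c * x) ∈ Complex.slitPlane := by
  right
  rcases hc with rfl | rfl <;> simp [Complex.inv_im, hx.ne']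

lemma norm_eps {c : ℂ} (hc : c = Complex.I ∨ c = -Complex.I) (x ε : ℝ) :
    |x| ≤ ‖(ε:ℂ) + c * x‖ := by
  have := Complex.abs_im_le_norm ((ε:ℂ) + c * x)
  rcases hc with rfl | rfl <;> simpa using this

lemma tendsto_eps {c : ℂ} (hc : c = Complex.I ∨ c = -Complex.I) {x : ℝ} (hx : 0 < x) (a : ℂ) :
    Tendsto (fun ε : ℝ => (1 / ((ε:ℂ) + c * x))^a) (nhdsWithin 0 (Set.Ioi 0)) (nhds ((1/(c*x))^a)) := by
  have h1 : c * x ≠ 0 := mul_ne_zero (c_facts hc).2.2.1 (by exact_mod_cast hx.ne')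
  have h2 : Tendsto (fun ε : ℝ => (1 / ((ε:ℂ) + c * x))) (nhds 0) (nhds (1/(c*x))) := by
    apply Tendsto.div tendsto_const_nhds _ h1
    exact (by fun_prop : Continuous fun ε : ℝ => (ε:ℂ) + c * x).tendsto' _ _ (by simp)
  exact ((continuousAt_cpow_const (slit_c hc hx)).tendsto.comp h2).mono_left nhdsWithin_le_nhds

lemma osc_gamma {c s : ℂ} (hc : c = Complex.I ∨ c = -Complex.I) (hs0 : 0 < s.re) (hs1 : s.re < 1) :
    Tendsto (fun T : ℝ => ∫ u in (0:ℝ)..T, (u:ℂ)^(s-1) * Complex.exp (c*u)) atTop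
      (nhds ((1/(-c))^s * Complex.Gamma s)) := by
  have hc' : -c = Complex.I ∨ -c = -Complex.I := by
    rcases hc with rfl | rfl <;> simp
  have hint : ∀ (r : ℂ) (a b : ℝ), IntervalIntegrable (fun u : ℝ => (u:ℂ)^(s-1) * Complex.exp (-(r*u))) volume a b := by
    intro r a b
    apply (intervalIntegrable_cpow' (by simpa using hs0)).mul_continuousOn
    fun_prop
  set C := (2 + ‖s-1‖ / (1 - s.re)) with hC
  -- bound for positive ε
  have step1 : ∀ (ε T : ℝ), 0 < ε → 0 < T →
      ‖(1/((ε:ℂ) + -c * (1:ℝ)))^s * Complex.Gamma s - ∫ u in (0:ℝ)..T, (u:ℂ)^(s-1) * Complex.exp (-(((ε:ℂ) + -c * (1:ℝ))*u))‖ ≤ C * T^(s.re-1) := by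
    intro ε T hε hT
    set r : ℂ := (ε:ℂ) + -c * (1:ℝ) with hr
    have hre : r.re = ε := by simp [hr, (c_facts hc).2.1]
    have hrn : 1 ≤ ‖r‖ := by simpa [hr] using norm_eps hc' 1 ε
    have hr0 : 0 < r.re := by rw [hre]; exact hε
    have h1 := intervalIntegral_tendsto_integral_Ioi (μ := volume) 0 (gi_int hs0 hr0) tendsto_id
    rw [gi_val hs0 hr0] at h1
    refine le_of_tendsto (h1.sub_const (∫ u in (0:ℝ)..T, (u:ℂ)^(s-1) * Complex.exp (-(r*u)))).norm ?_
    filter_upwards [eventually_ge_atTop T] with T' hT'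
    rw [id, intervalIntegral.integral_interval_sub_left (hint _ _ _) (hint _ _ _)]
    exact tail_bd hs1 hr0.le hrn hT hT'
  have step2 : ∀ T : ℝ, 0 < T →
      ‖(1/(-c * (1:ℝ)))^s * Complex.Gamma s - ∫ u in (0:ℝ)..T, (u:ℂ)^(s-1) * Complex.exp (c*u)‖ ≤ C * T^(s.re-1) := by
    intro T hT
    have h1 : Tendsto (fun ε : ℝ => ∫ u in (0:ℝ)..T, (u:ℂ)^(s-1) * Complex.exp (-(((ε:ℂ) + -c * (1:ℝ))*u)))
        (nhdsWithin 0 (Set.Ioi 0)) (nhds (∫ u in (0:ℝ)..T, (u:ℂ)^(s-1) * Complex.exp (c*u))) := by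
      apply intervalIntegral.tendsto_integral_filter_of_dominated_convergence (fun u => u^(s.re-1))
      · refine Eventually.of_forall fun ε => ?_
        rw [Set.uIoc_of_le hT.le]
        exact ((gi_cont s _).mono (fun u hu => hu.1)).aestronglyMeasurable measurableSet_Ioc
      · filter_upwards [self_mem_nhdsWithin] with ε hε
        refine Eventually.of_forall fun u hu => ?_
        rw [Set.uIoc_of_le hT.le] at hu
        rw [gi_norm s _ hu.1]
        have hε' : 0 < ε := hε
        have hu0 := hu.1
        have hre : ((ε:ℂ) + -c * (1:ℝ)).re = ε := by simp [(c_facts hc).2.1]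
        rw [hre]
        have : Real.exp (-ε * u) ≤ 1 := Real.exp_le_one_iff.2 (by nlinarith)
        exact mul_le_of_le_one_right (by positivity) this
      · exact intervalIntegrable_rpow' (by linarith)
      · refine Eventually.of_forall fun u _ => ?_
        have : Continuous fun ε : ℝ => (u:ℂ)^(s-1) * Complex.exp (-(((ε:ℂ) + -c * (1:ℝ))*u)) := by fun_prop
        exact (this.tendsto' 0 _ (by simp)).mono_left nhdsWithin_le_nhds
    have h2 := ((tendsto_eps hc' one_pos s).mul_const (Complex.Gamma s)).sub h1
    refine le_of_tendsto h2.norm ?_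
    filter_upwards [self_mem_nhdsWithin] with ε hε
    exact step1 ε T hε hT
  rw [tendsto_iff_norm_sub_tendsto_zero]
  have h0 : Tendsto (fun T : ℝ => C * T^(s.re-1)) atTop (nhds 0) := by
    have := (tendsto_rpow_neg_atTop (y := 1 - s.re) (by linarith)).const_mul C
    simpa using this
  refine squeeze_zero' (Eventually.of_forall fun _ => norm_nonneg _) ?_ h0
  filter_upwards [eventually_gt_atTop 0] with T hT
  rw [norm_sub_rev]
  simpa using step2 T hT

lemma KK_cont (c : ℂ) (R : ℝ) : Continuous (KK c R) := by
  unfold KK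
  apply intervalIntegral.continuous_parametric_intervalIntegral_of_continuous'
  fun_prop

noncomputable def bnd (σ x : ℝ) : ℝ :=
  (Set.Ioc (0:ℝ) 1).indicator (fun x => 4 * x^(σ-1)) x + (Set.Ioi (1:ℝ)).indicator (fun x => 20 * x^(σ-1-3/8)) x

lemma bnd_int {σ : ℝ} (h0 : 0 < σ) (h1 : σ < 3/8) : IntegrableOn (bnd σ) (Set.Ioi 0) := by
  apply Integrable.integrableOn
  apply Integrable.add
  · rw [integrable_indicator_iff measurableSet_Ioc]
    have : IntervalIntegrable (fun x : ℝ => x^(σ-1)) volume 0 1 := intervalIntegrable_rpow' (by linarith)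
    exact ((intervalIntegrable_iff_integrableOn_Ioc_of_le zero_le_one).1 this).const_mul 4
  · rw [integrable_indicator_iff measurableSet_Ioi]
    exact (integrableOn_Ioi_rpow_of_lt (by linarith) one_pos).const_mul 20

lemma KK_bnd {c : ℂ} (hc : c = Complex.I ∨ c = -Complex.I) {R x : ℝ} (hR : 0 ≤ R) (lam : ℂ)
    (hx : 0 < x) : ‖(x:ℂ)^(lam-1) * KK c R x‖ ≤ bnd lam.re x := by
  rw [norm_mul, Complex.norm_cpow_eq_rpow_re_of_pos hx, Complex.sub_re, Complex.one_re]
  unfold bnd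
  have hp : 0 ≤ x^(lam.re-1) := by positivity
  rcases le_or_gt x 1 with h | h
  · rw [Set.indicator_of_mem (show x ∈ Set.Ioc (0:ℝ) 1 from ⟨hx, h⟩), Set.indicator_of_notMem (by simpa using h), add_zero, mul_comm 4]
    exact mul_le_mul_of_nonneg_left (KK_small hc R x hR h) hp
  · rw [Set.indicator_of_notMem (by simp [h]), Set.indicator_of_mem (show x ∈ Set.Ioi (1:ℝ) from h), zero_add]
    refine (mul_le_mul_of_nonneg_left (KK_large hc R x hR hx) hp).trans (le_of_eq ?_)
    rw [sub_eq_add_neg (lam.re - 1), Real.rpow_add hx]; ring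

lemma meas_pow (lam : ℂ) {f : ℝ → ℂ} (hf : Continuous f) :
    AEStronglyMeasurable (fun x : ℝ => (x:ℂ)^(lam-1) * f x) (volume.restrict (Set.Ioi 0)) := by
  apply ContinuousOn.aestronglyMeasurable _ measurableSet_Ioi
  apply ContinuousOn.mul _ hf.continuousOn
  intro t ht
  apply ContinuousAt.continuousWithinAt
  exact (continuousAt_cpow_const (Complex.ofReal_mem_slitPlane.2 ht)).comp (f := fun t : ℝ => (t:ℂ)) (by fun_prop)

lemma fub {c : ℂ} (hc : c = Complex.I ∨ c = -Complex.I) {R ε : ℝ} (hε : 0 < ε) {lam : ℂ}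
    (hl : 0 < lam.re) :
    ∫ x in Set.Ioi (0:ℝ), (x:ℂ)^(lam-1) * (Complex.exp (-((ε:ℂ)*x)) * KK c R x) =
    ∫ ξ in (0:ℝ)..R, Complex.exp (c * ξ^5) * ((1/((ε:ℂ) + c*ξ))^lam * Complex.Gamma lam) := by
  have hre : ∀ ξ : ℝ, ((ε:ℂ) + c*ξ).re = ε := fun ξ => by simp [(c_facts hc).2.1]
  have e : ∀ ξ x : ℝ, Complex.exp (c * ξ^5) * ((x:ℂ)^(lam-1) * Complex.exp (-(((ε:ℂ) + c*ξ)*x))) =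
      Complex.exp (c * ((ξ^5 - x * ξ : ℝ) : ℂ)) * (1 * ((x:ℂ)^(lam-1) * Complex.exp (-((ε:ℂ)*x)))) := by
    intro ξ x
    rw [mul_left_comm, ← Complex.exp_add, one_mul, mul_left_comm (Complex.exp _), ← Complex.exp_add]
    congr 2; push_cast; ring
  have h := intervalIntegral_integral_swap (μ := volume.restrict (Set.Ioi (0:ℝ))) (a := 0) (b := R)
    (f := fun (ξ x : ℝ) => Complex.exp (c * ξ^5) * ((x:ℂ)^(lam-1) * Complex.exp (-(((ε:ℂ) + c*ξ)*x)))) ?_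
  · have h2 : ∀ ξ : ℝ, ∫ x in Set.Ioi (0:ℝ), Complex.exp (c * ξ^5) * ((x:ℂ)^(lam-1) * Complex.exp (-(((ε:ℂ) + c*ξ)*x))) =
        Complex.exp (c * ξ^5) * ((1/((ε:ℂ) + c*ξ))^lam * Complex.Gamma lam) := by
      intro ξ
      rw [MeasureTheory.integral_const_mul, gi_val hl (by rw [hre]; exact hε)]
    simp only [h2] at h
    rw [h]
    congr 1
    funext x
    simp only [e]
    rw [intervalIntegral.integral_mul_const]
    unfold KK
    ring
  · have h1 : Integrable (fun _ : ℝ => (1:ℂ)) (volume.restrict (Set.uIoc 0 R)) := by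
      rw [integrable_const_iff]; right
      exact ⟨by simp [Set.uIoc]⟩
    have h2 := h1.mul_prod (gi_int hl (r := ε) (by simpa using hε))
    have h3 := h2.bdd_mul (c := 1) (f := fun z : ℝ × ℝ => Complex.exp (c * ((z.1^5 - z.2 * z.1 : ℝ) : ℂ)))
      (by apply Continuous.aestronglyMeasurable; fun_prop) (Eventually.of_forall fun z => (norm_exp_c hc _).le)
    refine h3.congr (Eventually.of_forall fun z => ?_)
    exact (e z.1 z.2).symm

lemma mell {c : ℂ} (hc : c = Complex.I ∨ c = -Complex.I) {R : ℝ} (hR : 0 ≤ R) {lam : ℂ}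
    (hl : 0 < lam.re) (hl2 : lam.re < 3/8) :
    ∫ x in Set.Ioi (0:ℝ), (x:ℂ)^(lam-1) * KK c R x =
    ∫ ξ in (0:ℝ)..R, Complex.exp (c * ξ^5) * ((1/(c*ξ))^lam * Complex.Gamma lam) := by
  have A : Tendsto (fun ε : ℝ => ∫ x in Set.Ioi (0:ℝ), (x:ℂ)^(lam-1) * (Complex.exp (-((ε:ℂ)*x)) * KK c R x))
      (nhdsWithin 0 (Set.Ioi 0)) (nhds (∫ x in Set.Ioi (0:ℝ), (x:ℂ)^(lam-1) * KK c R x)) := by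
    apply MeasureTheory.tendsto_integral_filter_of_dominated_convergence (bnd lam.re) _ _ (bnd_int hl hl2)
    · refine (ae_restrict_iff' measurableSet_Ioi).2 (Eventually.of_forall fun x hx => ?_)
      have : Continuous fun ε : ℝ => (x:ℂ)^(lam-1) * (Complex.exp (-((ε:ℂ)*x)) * KK c R x) := by fun_prop
      exact (this.tendsto' 0 _ (by simp)).mono_left nhdsWithin_le_nhds
    · refine Eventually.of_forall fun ε => ?_
      have := KK_cont c R
      apply meas_pow; fun_prop
    · filter_upwards [self_mem_nhdsWithin] with ε hε
      refine (ae_restrict_iff' measurableSet_Ioi).2 (Eventually.of_forall fun x hx => ?_)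
      have hε' : 0 < ε := hε
      have hx' : 0 < x := hx
      rw [mul_left_comm, norm_mul]
      refine (mul_le_of_le_one_left (norm_nonneg _) ?_).trans (KK_bnd hc hR lam hx)
      rw [Complex.norm_exp]
      apply Real.exp_le_one_iff.2
      simp; positivity
  have Bt : Tendsto (fun ε : ℝ => ∫ ξ in (0:ℝ)..R, Complex.exp (c * ξ^5) * ((1/((ε:ℂ) + c*ξ))^lam * Complex.Gamma lam))
      (nhdsWithin 0 (Set.Ioi 0)) (nhds (∫ ξ in (0:ℝ)..R, Complex.exp (c * ξ^5) * ((1/(c*ξ))^lam * Complex.Gamma lam))) := by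
    apply intervalIntegral.tendsto_integral_filter_of_dominated_convergence
      (fun ξ => ξ^(-lam.re) * (Real.exp (Real.pi * |lam.im|) * ‖Complex.Gamma lam‖))
    · refine Eventually.of_forall fun ε => ?_
      apply Measurable.aestronglyMeasurable
      have : Measurable fun ξ : ℝ => (1/((ε:ℂ) + c*ξ))^lam := by
        apply Measurable.pow_const
        fun_prop
      fun_prop
    · filter_upwards [self_mem_nhdsWithin] with ε hε
      refine Eventually.of_forall fun ξ hξ => ?_
      rw [Set.uIoc_of_le hR] at hξ
      have h5 : ‖Complex.exp (c * ξ^5)‖ = 1 := by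
        have := norm_exp_c hc (ξ^5); push_cast at this; exact this
      rw [norm_mul, h5, one_mul, norm_mul, ← mul_assoc]
      gcongr
      refine (Complex.norm_cpow_le _ _).trans ?_
      rw [div_eq_mul_inv, ← Real.exp_neg]
      have hξ0 := hξ.1
      gcongr
      · rw [Real.rpow_neg hξ0.le, ← Real.inv_rpow hξ0.le, norm_div, norm_one, one_div]
        gcongr
        have := norm_eps hc ξ ε
        rwa [abs_of_pos hξ0] at this
      · set z := 1 / ((ε:ℂ) + c*ξ)
        calc -(z.arg * lam.im) ≤ |z.arg * lam.im| := neg_le_abs _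
          _ = |z.arg| * |lam.im| := abs_mul _ _
          _ ≤ _ := by gcongr; exact Complex.abs_arg_le_pi z
    · exact (intervalIntegrable_rpow' (by linarith)).mul_const _
    · refine Eventually.of_forall fun ξ hξ => ?_
      rw [Set.uIoc_of_le hR] at hξ
      exact ((tendsto_eps hc hξ.1 lam).mul_const _).const_mul _
  refine tendsto_nhds_unique A (Bt.congr' ?_)
  filter_upwards [self_mem_nhdsWithin] with ε hε
  exact (fub hc hε hl).symm

lemma cpow_split {c : ℂ} (hc : c = Complex.I ∨ c = -Complex.I) {ξ : ℝ} (hξ : 0 < ξ) (lam : ℂ) :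
    (1/(c*ξ))^lam = (1/c)^lam * (ξ:ℂ)^(-lam) := by
  have h0 := (c_facts hc).2.2.1
  have hξc : (ξ:ℂ) ≠ 0 := by exact_mod_cast hξ.ne'
  have e : 1/(c*ξ) = ((ξ⁻¹:ℝ):ℂ) * (1/c) := by push_cast; field_simp
  have h1 : 1/c ≠ 0 := by simpa using h0
  rw [e, Complex.cpow_def_of_ne_zero (mul_ne_zero (by simpa using hξc) h1),
    Complex.log_ofReal_mul (by positivity) h1, Complex.cpow_def_of_ne_zero h1,
    Complex.cpow_def_of_ne_zero hξc, ← Complex.exp_add, Real.log_inv, ← Complex.ofReal_log hξ.le]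
  congr 1; push_cast; ring

lemma chg {c : ℂ} {R : ℝ} (hR : 0 < R) (lam : ℂ) :
    ∫ ξ in (0:ℝ)..R, Complex.exp (c * ξ^5) * (ξ:ℂ)^(-lam) =
    (1/5) * ∫ u in (0:ℝ)..R^5, (u:ℂ)^((1-lam)/5-1) * Complex.exp (c*u) := by
  have h := integral_comp_rpow_Ioi_of_pos (p := 5) (by norm_num)
    (g := (Set.Iic (R^5)).indicator (fun u : ℝ => (u:ℂ)^((1-lam)/5-1) * Complex.exp (c*u)))
  rw [setIntegral_indicator measurableSet_Iic, Set.Ioi_inter_Iic, ← intervalIntegral.integral_of_le (by positivity)] at h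
  rw [← h, intervalIntegral.integral_of_le hR.le, ← Set.Ioi_inter_Iic, ← setIntegral_indicator measurableSet_Iic,
    ← MeasureTheory.integral_const_mul]
  apply setIntegral_congr_fun measurableSet_Ioi
  intro x hx
  have hx' : 0 < x := hx
  have hxc : (x:ℂ) ≠ 0 := by exact_mod_cast hx'.ne'
  have e5 : x^(5:ℝ) = x^5 := by exact_mod_cast Real.rpow_natCast x 5
  have e4 : x^((5:ℝ)-1) = x^4 := by norm_num
  simp only [e5, e4]
  by_cases hxR : x ≤ R
  · rw [Set.indicator_of_mem (show x ∈ Set.Iic R from hxR), Set.indicator_of_mem (show x^5 ∈ Set.Iic (R^5) from pow_le_pow_left₀ hx'.le hxR 5)]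
    have hx5c : ((x^5:ℝ):ℂ) ≠ 0 := by exact_mod_cast (pow_pos hx' 5).ne'
    have e : (x:ℂ)^(-lam) = (x:ℂ)^4 * ((x^5:ℝ):ℂ)^((1-lam)/5-1) := by
      rw [Complex.cpow_def_of_ne_zero hx5c, ← Complex.ofReal_log (by positivity), Real.log_pow, Complex.cpow_def_of_ne_zero hxc,
        ← Complex.ofReal_log hx'.le]
      have : (x:ℂ)^4 = Complex.exp (4 * (Real.log x : ℝ)) := by
        rw [← Real.exp_log hx', ]
        simp only [Real.log_exp]
        rw [Complex.ofReal_exp, ← Complex.exp_nat_mul]; norm_num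
      rw [this, ← Complex.exp_add]
      congr 1; push_cast; ring
    rw [e, Complex.real_smul]
    push_cast
    ring
  · rw [Set.indicator_of_notMem (by simpa using hxR), Set.indicator_of_notMem, smul_zero, mul_zero]
    simp only [Set.mem_Iic, not_le] at hxR ⊢
    exact pow_lt_pow_left₀ hxR hR.le (by norm_num)

lemma mell_lim {c : ℂ} (hc : c = Complex.I ∨ c = -Complex.I) {lam : ℂ}
    (hl : 0 < lam.re) (hl2 : lam.re < 3/8) :
    Tendsto (fun R : ℝ => ∫ x in Set.Ioi (0:ℝ), (x:ℂ)^(lam-1) * KK c R x) atTop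
    (nhds (Complex.Gamma lam * (1/c)^lam * ((1/5) * ((1/(-c))^((1-lam)/5) * Complex.Gamma ((1-lam)/5))))) := by
  have hre : ((1-lam)/5).re = (1 - lam.re)/5 := by
    simp
  have h1 := (osc_gamma hc (s := (1-lam)/5) (by rw [hre]; linarith) (by rw [hre]; linarith)).comp
    (tendsto_pow_atTop (α := ℝ) (n := 5) (by norm_num))
  have h2 := (h1.const_mul (1/5)).const_mul (Complex.Gamma lam * (1/c)^lam)
  refine h2.congr' ?_
  filter_upwards [eventually_gt_atTop 0] with R hR
  rw [mell hc hR.le hl hl2, Function.comp, ← chg hR, ← intervalIntegral.integral_const_mul]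
  apply intervalIntegral.integral_congr_ae
  refine Eventually.of_forall fun ξ hξ => ?_
  rw [Set.uIoc_of_le hR.le] at hξ
  rw [cpow_split hc hξ.1]
  ring

lemma KK_sum (R x : ℝ) : ∫ ξ in (-R)..R, Complex.exp (Complex.I * (((-x:ℝ) : ℂ) * (ξ : ℂ) + (ξ : ℂ)^5)) =
    KK Complex.I R x + KK (-Complex.I) R x := by
  have hi : ∀ a b : ℝ, IntervalIntegrable (fun ξ : ℝ => Complex.exp (Complex.I * (((-x:ℝ) : ℂ) * (ξ : ℂ) + (ξ : ℂ)^5))) volume a b := by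
    intro a b; apply Continuous.intervalIntegrable; fun_prop
  rw [← intervalIntegral.integral_add_adjacent_intervals (hi (-R) 0) (hi 0 R), add_comm]
  unfold KK
  congr 1
  · congr 1; funext ξ; congr 1; push_cast; ring
  · have := intervalIntegral.integral_comp_neg (a := 0) (b := R) (fun ξ : ℝ => Complex.exp (Complex.I * (((-x:ℝ) : ℂ) * (ξ : ℂ) + (ξ : ℂ)^5)))
    rw [neg_zero] at this
    rw [← this]
    congr 1; funext ξ; congr 1; push_cast; ring

lemma KK_int {c : ℂ} (hc : c = Complex.I ∨ c = -Complex.I) {R : ℝ} (hR : 0 ≤ R) {lam : ℂ}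
    (hl : 0 < lam.re) (hl2 : lam.re < 3/8) :
    IntegrableOn (fun x : ℝ => (x:ℂ)^(lam-1) * KK c R x) (Set.Ioi 0) := by
  refine Integrable.mono' (bnd_int hl hl2) (meas_pow lam (KK_cont c R)) ?_
  exact (ae_restrict_iff' measurableSet_Ioi).2 (Eventually.of_forall fun x hx => KK_bnd hc hR lam hx)

/-- Mellin transform of `x ↦ B(−x)` on `(0,∞)`: for `0 < Re λ < 3/8`,
`∫₀^∞ x^{λ−1} B(−x) dx = Γ(λ)Γ((1−λ)/5) cos((1−6λ)π/10)/(5π)`. -/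
theorem oscillatory_kernel_mellin_minus
    (B : ℝ → ℂ)
    (hB : ∀ x : ℝ, Tendsto
      (fun R : ℝ => (1 / (2 * (Real.pi : ℂ))) *
        ∫ ξ in (-R)..R, Complex.exp (Complex.I * ((x : ℂ) * (ξ : ℂ) + (ξ : ℂ)^5)))
      atTop (nhds (B x)))
    (lam : ℂ) (hlam₁ : 0 < lam.re) (hlam₂ : lam.re < 3/8) :
    ∫ x in Set.Ioi (0:ℝ), (x : ℂ)^(lam - 1) * B (-x)
      = Complex.Gamma lam * Complex.Gamma ((1 - lam)/5) *
          Complex.cos ((1 - 6*lam) * (Real.pi : ℂ) / 10) / (5 * (Real.pi : ℂ)) := by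
  have hp : Complex.I = Complex.I ∨ Complex.I = -Complex.I := Or.inl rfl
  have hm : -Complex.I = Complex.I ∨ -Complex.I = -Complex.I := Or.inr rfl
  have hpi : (Real.pi : ℂ) ≠ 0 := by exact_mod_cast Real.pi_ne_zero
  set k : ℂ := 1 / (2 * (Real.pi : ℂ)) with hk
  have L1 : Tendsto (fun R : ℝ => ∫ x in Set.Ioi (0:ℝ), (x:ℂ)^(lam-1) * (k * (KK Complex.I R x + KK (-Complex.I) R x)))
      atTop (nhds (∫ x in Set.Ioi (0:ℝ), (x : ℂ)^(lam - 1) * B (-x))) := by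
    apply MeasureTheory.tendsto_integral_filter_of_dominated_convergence (fun x => ‖k‖ * (bnd lam.re x + bnd lam.re x))
    · refine Eventually.of_forall fun R => ?_
      have := KK_cont Complex.I R
      have := KK_cont (-Complex.I) R
      apply meas_pow; fun_prop
    · filter_upwards [eventually_ge_atTop 0] with R hR
      refine (ae_restrict_iff' measurableSet_Ioi).2 (Eventually.of_forall fun x hx => ?_)
      rw [mul_left_comm, norm_mul, mul_add]
      gcongr
      exact (norm_add_le _ _).trans (add_le_add (KK_bnd hp hR lam hx) (KK_bnd hm hR lam hx))
    · exact ((bnd_int hlam₁ hlam₂).add (bnd_int hlam₁ hlam₂)).const_mul _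
    · refine Eventually.of_forall fun x => ?_
      have := (hB (-x)).const_mul ((x:ℂ)^(lam-1))
      simp only [KK_sum] at this
      exact this
  have L2 := ((mell_lim hp hlam₁ hlam₂).add (mell_lim hm hlam₁ hlam₂)).const_mul k
  have L3 := tendsto_nhds_unique L1 (L2.congr' ?_)
  · rw [L3]
    have i1 : 1 / Complex.I = -Complex.I := by simp
    have i2 : 1 / -Complex.I = Complex.I := by simp [inv_neg]
    rw [neg_neg, i1, i2]
    have p1 : ∀ w : ℂ, Complex.I^w = Complex.exp (Real.pi / 2 * Complex.I * w) := fun w => by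
      rw [Complex.cpow_def_of_ne_zero Complex.I_ne_zero, Complex.log_I]
    have p2 : ∀ w : ℂ, (-Complex.I)^w = Complex.exp (-(Real.pi / 2) * Complex.I * w) := fun w => by
      rw [Complex.cpow_def_of_ne_zero (neg_ne_zero.2 Complex.I_ne_zero), Complex.log_neg_I]
    rw [p1, p2, p1, p2, Complex.cos]
    have q1 : Complex.exp ((1 - 6*lam) * (Real.pi : ℂ) / 10 * Complex.I) =
        Complex.exp (-(Real.pi / 2) * Complex.I * lam) * Complex.exp (Real.pi / 2 * Complex.I * ((1-lam)/5)) := by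
      rw [← Complex.exp_add]; congr 1; ring
    have q2 : Complex.exp (-((1 - 6*lam) * (Real.pi : ℂ) / 10) * Complex.I) =
        Complex.exp (Real.pi / 2 * Complex.I * lam) * Complex.exp (-(Real.pi / 2) * Complex.I * ((1-lam)/5)) := by
      rw [← Complex.exp_add]; congr 1; ring
    rw [q1, q2, hk]
    field_simp
    try ring
  · filter_upwards [eventually_ge_atTop 0] with R hR
    rw [← integral_add (KK_int hp hR hlam₁ hlam₂) (KK_int hm hR hlam₁ hlam₂), ← MeasureTheory.integral_const_mul]
    congr 1; funext x; ring
end
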